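/- For all f, g ∈ C[0,1] one has the Chebyshev–Grüss inequality |∫₀¹ f(x)g(x) dx - (∫₀¹ f(x) dx)(∫₀¹ g(x) dx)| ≤ (1/4)·ω̃(f; 1/√3)·ω̃(g; 1/√3); moreover, if f and g are continuously differentiable on [0,1], then |∫₀¹ f(x)g(x) dx - (∫₀¹ f(x) dx)(∫₀¹ g(x) dx)| ≤ (1/12)·‖f′‖_∞·‖g′‖_∞. -/

import Mathlib

open Set Finset

noncomputable section

/-- First order modulus of continuity of `f` on `[a,b]`. -/
def omega1 (a b : ℝ) (f : ℝ → ℝ) (t : ℝ) : ℝ :=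
  sSup {v | ∃ x ∈ Set.Icc a b, ∃ y ∈ Set.Icc a b, |x - y| ≤ t ∧ v = |f x - f y|}

/-- Least concave majorant of the first order modulus of continuity on `[0,1]`. -/
def omegaTilde (f : ℝ → ℝ) (t : ℝ) : ℝ :=
  if t ≤ 1 then
    sSup {v | ∃ x y : ℝ, 0 ≤ x ∧ x ≤ t ∧ t ≤ y ∧ y ≤ 1 ∧ x ≠ y ∧
      v = ((t - x) * omega1 0 1 f y + (y - t) * omega1 0 1 f x) / (y - x)}
  else omega1 0 1 f 1

/-- The sup norm of `f` on `[a,b]`. -/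
def supAbs (a b : ℝ) (f : ℝ → ℝ) : ℝ := sSup ((fun x => |f x|) '' Set.Icc a b)

open MeasureTheory ProbabilityTheory in
/-- Cauchy–Schwarz for the covariance. -/
lemma abs_covariance_le_mul {Ω : Type*} {m : MeasurableSpace Ω} {μ : Measure Ω}
    [IsFiniteMeasure μ] {X Y : Ω → ℝ} (hX : MemLp X 2 μ) (hY : MemLp Y 2 μ) {p q : ℝ}
    (hp : 0 ≤ p) (hq : 0 ≤ q) (hXp : Var[X; μ] ≤ p ^ 2) (hYq : Var[Y; μ] ≤ q ^ 2) :
    |cov[X, Y; μ]| ≤ p * q := by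
  have h (c : ℝ) : 0 ≤ Var[Y; μ] * (c * c) + 2 * cov[X, Y; μ] * c + Var[X; μ] := by
    have := variance_nonneg (X + c • Y) μ
    rw [variance_add hX (hY.const_smul c), covariance_smul_right, variance_smul] at this
    linarith
  have hd := discrim_le_zero h
  rw [discrim] at hd
  apply abs_le_of_sq_le_sq _ (mul_nonneg hp hq)
  have := mul_le_mul hXp hYq (variance_nonneg Y μ) (sq_nonneg p)
  nlinarith

lemma memLp_two_Ioc_of_continuousOn_Icc {a b : ℝ} {f : ℝ → ℝ}
    (hf : ContinuousOn f (Set.Icc a b)) :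
    MeasureTheory.MemLp f 2 (MeasureTheory.volume.restrict (Set.Ioc a b)) := by
  obtain ⟨C, hC⟩ := isCompact_Icc.exists_bound_of_continuousOn hf
  refine MeasureTheory.MemLp.of_bound
    ((hf.mono Set.Ioc_subset_Icc_self).aestronglyMeasurable measurableSet_Ioc) C ?_
  filter_upwards [MeasureTheory.ae_restrict_mem measurableSet_Ioc] with x hx
  exact hC x (Set.Ioc_subset_Icc_self hx)

instance isProbabilityMeasure_restrict_Ioc_zero_one :
    MeasureTheory.IsProbabilityMeasure
      ((MeasureTheory.volume : MeasureTheory.Measure ℝ).restrict (Set.Ioc 0 1)) :=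
  ⟨by simp⟩

/-- If the oscillation of `f` is bounded by an affine function of the distance, then `f` differs
from some constant by at most half the intercept plus the slope times the distance to a
given point. -/
lemma exists_const_approx {s : Set ℝ} (hs : s.Nonempty) {f : ℝ → ℝ} {A M : ℝ} (hM : 0 ≤ M)
    (h : ∀ x ∈ s, ∀ y ∈ s, |f x - f y| ≤ A + M * |x - y|) (z : ℝ) :
    ∃ c, ∀ x ∈ s, |f x - c| ≤ A / 2 + M * |x - z| := by
  obtain ⟨c, hc₁, hc₂⟩ := exists_between_of_forall_le
    (hs.image fun x => f x - (A / 2 + M * |x - z|)) (hs.image fun x => f x + (A / 2 + M * |x - z|))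
    (by
      rintro _ ⟨x, hx, rfl⟩ _ ⟨y, hy, rfl⟩
      have h₁ := (le_abs_self _).trans (h x hx y hy)
      have h₂ := mul_le_mul_of_nonneg_left (abs_sub_le x z y) hM
      rw [abs_sub_comm z y] at h₂
      dsimp only
      linarith)
  refine ⟨c, fun x hx => abs_le.2 ?_⟩
  have h₁ := hc₁ ⟨x, hx, rfl⟩
  have h₂ := hc₂ ⟨x, hx, rfl⟩
  dsimp only at h₁ h₂
  constructor <;> linarith

open MeasureTheory ProbabilityTheory in
lemma variance_le_of_affine_oscillation {f : ℝ → ℝ} (hf : ContinuousOn f (Set.Icc 0 1)) {A M : ℝ}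
    (hA : 0 ≤ A) (hM : 0 ≤ M)
    (h : ∀ x ∈ Set.Icc (0 : ℝ) 1, ∀ y ∈ Set.Icc (0 : ℝ) 1, |f x - f y| ≤ A + M * |x - y|) :
    Var[f; volume.restrict (Set.Ioc 0 1)] ≤ (1 / 2 * (A + M * (1 / Real.sqrt 3))) ^ 2 := by
  obtain ⟨c, hc⟩ := exists_const_approx (Set.nonempty_Icc.2 zero_le_one) hM h (1 / 2)
  have hLp := memLp_two_Ioc_of_continuousOn_Icc hf
  have hLp' := memLp_two_Ioc_of_continuousOn_Icc (hf.sub (continuousOn_const (c := c)))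
  have h3 : Real.sqrt 3 ^ 2 = 3 := Real.sq_sqrt (by norm_num)
  have h3' : 0 < Real.sqrt 3 := by positivity
  have hinv : 1 / Real.sqrt 3 = Real.sqrt 3 / 3 := by field_simp; linarith
  calc
    Var[f; volume.restrict (Set.Ioc 0 1)]
        = Var[fun x => f x - c; volume.restrict (Set.Ioc 0 1)] :=
      (variance_sub_const hLp.1 c).symm
    _ ≤ ∫ x in Set.Ioc 0 1, (f x - c) ^ 2 := variance_le_expectation_sq hLp'.1
    _ ≤ ∫ x in Set.Ioc (0 : ℝ) 1, (A ^ 2 / 4 + A * M * Real.sqrt 3 / 12 +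
          (A * M * Real.sqrt 3 + M ^ 2) * (x - 1 / 2) ^ 2) := by
      refine setIntegral_mono_on hLp'.integrable_sq ?_ measurableSet_Ioc fun x hx => ?_
      · exact (Continuous.integrableOn_Icc (by fun_prop)).mono_set Set.Ioc_subset_Icc_self
      · refine (sq_le_sq' (abs_le.1 (hc x (Set.Ioc_subset_Icc_self hx))).1
          (abs_le.1 (hc x (Set.Ioc_subset_Icc_self hx))).2).trans ?_
        have habs : |x - 1 / 2| ≤ Real.sqrt 3 / 12 + Real.sqrt 3 * |x - 1 / 2| ^ 2 := by
          have := mul_nonneg h3'.le (sq_nonneg (|x - 1 / 2| - Real.sqrt 3 / 6))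
          nlinarith
        have := mul_le_mul_of_nonneg_left habs (mul_nonneg hA hM)
        rw [← sq_abs (x - 1 / 2)]
        nlinarith
    _ = (1 / 2 * (A + M * (1 / Real.sqrt 3))) ^ 2 := by
      rw [← intervalIntegral.integral_of_le zero_le_one, intervalIntegral.integral_add,
        intervalIntegral.integral_const, intervalIntegral.integral_const_mul,
        intervalIntegral.integral_comp_sub_right (fun x => x ^ 2), integral_pow, hinv]
      · norm_num
        linear_combination (-M ^ 2 / 36) * h3
      · exact intervalIntegrable_const
      · exact Continuous.intervalIntegrable (by fun_prop) _ _

lemma abs_integral_mul_sub_le {f g : ℝ → ℝ} (hf : ContinuousOn f (Set.Icc 0 1))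
    (hg : ContinuousOn g (Set.Icc 0 1)) {A M B N : ℝ}
    (hA : 0 ≤ A) (hM : 0 ≤ M) (hB : 0 ≤ B) (hN : 0 ≤ N)
    (hfA : ∀ x ∈ Set.Icc (0 : ℝ) 1, ∀ y ∈ Set.Icc (0 : ℝ) 1, |f x - f y| ≤ A + M * |x - y|)
    (hgB : ∀ x ∈ Set.Icc (0 : ℝ) 1, ∀ y ∈ Set.Icc (0 : ℝ) 1, |g x - g y| ≤ B + N * |x - y|) :
    |(∫ x in (0 : ℝ)..1, f x * g x) - (∫ x in (0 : ℝ)..1, f x) * ∫ x in (0 : ℝ)..1, g x| ≤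
      1 / 4 * (A + M * (1 / Real.sqrt 3)) * (B + N * (1 / Real.sqrt 3)) := by
  have hfL := memLp_two_Ioc_of_continuousOn_Icc hf
  have hgL := memLp_two_Ioc_of_continuousOn_Icc hg
  have key := abs_covariance_le_mul hfL hgL (by positivity) (by positivity)
    (variance_le_of_affine_oscillation hf hA hM hfA)
    (variance_le_of_affine_oscillation hg hB hN hgB)
  rw [ProbabilityTheory.covariance_eq_sub hfL hgL] at key
  simp only [intervalIntegral.integral_of_le (zero_le_one' ℝ)]
  exact key.trans_eq (by ring)

section omega1

variable {a b : ℝ} {f : ℝ → ℝ}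

lemma bddAbove_omega1 (hf : ContinuousOn f (Set.Icc a b)) (t : ℝ) :
    BddAbove {v | ∃ x ∈ Set.Icc a b, ∃ y ∈ Set.Icc a b, |x - y| ≤ t ∧ v = |f x - f y|} := by
  obtain ⟨C, hC⟩ := isCompact_Icc.exists_bound_of_continuousOn hf
  refine ⟨C + C, ?_⟩
  rintro _ ⟨x, hx, y, hy, -, rfl⟩
  exact (norm_sub_le _ _).trans (add_le_add (hC x hx) (hC y hy))

lemma abs_sub_le_omega1 (hf : ContinuousOn f (Set.Icc a b)) {x y : ℝ} (hx : x ∈ Set.Icc a b)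
    (hy : y ∈ Set.Icc a b) : |f x - f y| ≤ omega1 a b f |x - y| :=
  le_csSup (bddAbove_omega1 hf _) ⟨x, hx, y, hy, le_rfl, rfl⟩

lemma omega1_nonneg (t : ℝ) : 0 ≤ omega1 a b f t := by
  apply Real.sSup_nonneg
  rintro _ ⟨x, -, y, -, -, rfl⟩
  exact abs_nonneg _

lemma omega1_le_of_le (hf : ContinuousOn f (Set.Icc a b)) {s t : ℝ} (hst : s ≤ t) :
    omega1 a b f s ≤ omega1 a b f t := by
  refine Real.sSup_le ?_ (omega1_nonneg t)
  rintro _ ⟨x, hx, y, hy, hxy, rfl⟩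
  exact le_csSup (bddAbove_omega1 hf t) ⟨x, hx, y, hy, hxy.trans hst, rfl⟩

end omega1

lemma chord_le_omegaTilde {f : ℝ → ℝ} (hf : ContinuousOn f (Set.Icc 0 1)) {t x y : ℝ}
    (hx : 0 ≤ x) (hxt : x ≤ t) (hty : t ≤ y) (hy : y ≤ 1) (hxy : x ≠ y) :
    (t - x) * omega1 0 1 f y + (y - t) * omega1 0 1 f x ≤ omegaTilde f t * (y - x) := by
  have hpos : 0 < y - x := sub_pos.2 (lt_of_le_of_ne (hxt.trans hty) hxy)
  rw [← div_le_iff₀ hpos, omegaTilde, if_pos (hty.trans hy)]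
  refine le_csSup ⟨omega1 0 1 f 1, ?_⟩ ⟨x, y, hx, hxt, hty, hy, hxy, rfl⟩
  rintro _ ⟨u, v, hu, hut, htv, hv, huv, rfl⟩
  have huv' : 0 < v - u := sub_pos.2 (lt_of_le_of_ne (hut.trans htv) huv)
  rw [div_le_iff₀ huv']
  have h₁ := mul_le_mul_of_nonneg_left (omega1_le_of_le hf hv) (sub_nonneg.2 hut)
  have h₂ := mul_le_mul_of_nonneg_left (omega1_le_of_le hf (hut.trans (htv.trans hv)))
    (sub_nonneg.2 htv)
  linarith

/-- The least concave majorant has a supporting line at every interior point. -/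
lemma exists_supporting_line {f : ℝ → ℝ} (hf : ContinuousOn f (Set.Icc 0 1)) {t : ℝ}
    (ht₀ : 0 < t) (ht₁ : t < 1) :
    ∃ A M : ℝ, 0 ≤ A ∧ 0 ≤ M ∧ A + M * t = omegaTilde f t ∧
      ∀ s ∈ Set.Icc (0 : ℝ) 1, omega1 0 1 f s ≤ A + M * s := by
  set W := omegaTilde f t with hW
  have hWt : omega1 0 1 f t ≤ W := by
    have := chord_le_omegaTilde hf ht₀.le le_rfl ht₁.le le_rfl ht₁.ne
    rw [sub_self, zero_mul, zero_add, mul_comm] at this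
    exact le_of_mul_le_mul_right this (sub_pos.2 ht₁)
  obtain ⟨M, hM₁, hM₂⟩ := exists_between_of_forall_le
    (s := insert 0 ((fun y => (omega1 0 1 f y - W) / (y - t)) '' Set.Ioc t 1))
    (t := (fun x => (W - omega1 0 1 f x) / (t - x)) '' Set.Ico 0 t)
    (Set.insert_nonempty _ _) ((Set.nonempty_Ico.2 ht₀).image _) (by
      rintro _ (rfl | ⟨y, ⟨hty, hy⟩, rfl⟩) _ ⟨x, ⟨hx, hxt⟩, rfl⟩
      · exact div_nonneg (sub_nonneg.2 ((omega1_le_of_le hf hxt.le).trans hWt))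
          (sub_pos.2 hxt).le
      · dsimp only
        rw [div_le_div_iff₀ (sub_pos.2 hty) (sub_pos.2 hxt)]
        have := chord_le_omegaTilde hf hx hxt.le hty.le hy (hxt.trans hty).ne
        linarith)
  have hline : ∀ s ∈ Set.Icc (0 : ℝ) 1, omega1 0 1 f s ≤ (W - M * t) + M * s := by
    rintro s ⟨hs₀, hs₁⟩
    rcases lt_trichotomy s t with hst | rfl | hst
    · have := hM₂ ⟨s, ⟨hs₀, hst⟩, rfl⟩
      rw [le_div_iff₀ (sub_pos.2 hst)] at this
      linarith
    · linarith
    · have := hM₁ (Or.inr ⟨s, ⟨hst, hs₁⟩, rfl⟩)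
      rw [div_le_iff₀ (sub_pos.2 hst)] at this
      linarith
  refine ⟨W - M * t, M, ?_, hM₁ (Or.inl rfl), by ring, hline⟩
  have := (omega1_nonneg 0).trans (hline 0 ⟨le_rfl, zero_le_one⟩)
  linarith

lemma exists_affine_oscillation_bound {f : ℝ → ℝ} (hf : ContinuousOn f (Set.Icc 0 1)) {t : ℝ}
    (ht₀ : 0 < t) (ht₁ : t < 1) :
    ∃ A M : ℝ, 0 ≤ A ∧ 0 ≤ M ∧ A + M * t = omegaTilde f t ∧
      ∀ x ∈ Set.Icc (0 : ℝ) 1, ∀ y ∈ Set.Icc (0 : ℝ) 1, |f x - f y| ≤ A + M * |x - y| := by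
  obtain ⟨A, M, hA, hM, hAM, h⟩ := exists_supporting_line hf ht₀ ht₁
  refine ⟨A, M, hA, hM, hAM, fun x hx y hy => (abs_sub_le_omega1 hf hx hy).trans (h _ ?_)⟩
  exact ⟨abs_nonneg _, abs_sub_le_iff.2 ⟨by linarith [hx.2, hy.1], by linarith [hx.1, hy.2]⟩⟩

lemma supAbs_nonneg (a b : ℝ) (f : ℝ → ℝ) : 0 ≤ supAbs a b f := by
  apply Real.sSup_nonneg
  rintro _ ⟨x, -, rfl⟩
  exact abs_nonneg _

lemma abs_sub_le_supAbs_derivWithin {a b : ℝ} (hab : a < b) {f : ℝ → ℝ}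
    (hf : ContDiffOn ℝ 1 f (Set.Icc a b)) {x y : ℝ} (hx : x ∈ Set.Icc a b)
    (hy : y ∈ Set.Icc a b) :
    |f x - f y| ≤ supAbs a b (derivWithin f (Set.Icc a b)) * |x - y| := by
  have hcont := hf.continuousOn_derivWithin (uniqueDiffOn_Icc hab) le_rfl
  exact (convex_Icc a b).norm_image_sub_le_of_norm_derivWithin_le
    (hf.differentiableOn one_ne_zero)
    (fun z hz => le_csSup (isCompact_Icc.image_of_continuousOn hcont.abs).bddAbove ⟨z, hz, rfl⟩)
    hy hx

theorem chebyshev_gruss_integral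
    (f g : ℝ → ℝ) (hf : ContinuousOn f (Set.Icc 0 1)) (hg : ContinuousOn g (Set.Icc 0 1)) :
    |(∫ x in (0 : ℝ)..1, f x * g x) -
        (∫ x in (0 : ℝ)..1, f x) * ∫ x in (0 : ℝ)..1, g x| ≤
        1 / 4 * omegaTilde f (1 / Real.sqrt 3) * omegaTilde g (1 / Real.sqrt 3) ∧
      (ContDiffOn ℝ 1 f (Set.Icc 0 1) → ContDiffOn ℝ 1 g (Set.Icc 0 1) →
        |(∫ x in (0 : ℝ)..1, f x * g x) -
            (∫ x in (0 : ℝ)..1, f x) * ∫ x in (0 : ℝ)..1, g x| ≤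
          1 / 12 * supAbs 0 1 (derivWithin f (Set.Icc 0 1)) *
            supAbs 0 1 (derivWithin g (Set.Icc 0 1))) := by
  have ht₀ : 0 < 1 / Real.sqrt 3 := by positivity
  have ht₁ : 1 / Real.sqrt 3 < 1 := by
    rw [div_lt_one (by positivity), Real.lt_sqrt zero_le_one]
    norm_num
  constructor
  · obtain ⟨A, M, hA, hM, hAM, hfA⟩ := exists_affine_oscillation_bound hf ht₀ ht₁
    obtain ⟨B, N, hB, hN, hBN, hgB⟩ := exists_affine_oscillation_bound hg ht₀ ht₁
    rw [← hAM, ← hBN]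
    exact abs_integral_mul_sub_le hf hg hA hM hB hN hfA hgB
  · intro hf' hg'
    refine (abs_integral_mul_sub_le hf hg le_rfl (supAbs_nonneg _ _ _) le_rfl
      (supAbs_nonneg _ _ _)
      (fun x hx y hy => (abs_sub_le_supAbs_derivWithin zero_lt_one hf' hx hy).trans_eq
        (zero_add _).symm)
      (fun x hx y hy => (abs_sub_le_supAbs_derivWithin zero_lt_one hg' hx hy).trans_eq
        (zero_add _).symm)).trans_eq ?_
    have h3 : 1 / Real.sqrt 3 * (1 / Real.sqrt 3) = 1 / 3 := by
      rw [div_mul_div_comm, Real.mul_self_sqrt (by norm_num), one_mul]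
    linear_combination (1 / 4 * supAbs 0 1 (derivWithin f (Set.Icc 0 1)) *
      supAbs 0 1 (derivWithin g (Set.Icc 0 1))) * h3
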